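/- For every integer k ≥ 2 and every ε > 0 there exists N such that for all even n ≥ N there is a family of perfect matchings of the complete graph K_n of size at least n^{(1/(3k−2) − ε)n} in which the union of no two matchings contains a cycle of length 2k. -/

import Mathlib

open SimpleGraph

/-- `G` contains a cycle of length `k` as a subgraph. -/
def ContainsCycleLen {V : Type*} (G : SimpleGraph V) (k : ℕ) : Prop :=
  ∃ (u : V) (w : G.Walk u u), w.IsCycle ∧ w.length = k

/-- `H` is a Hamiltonian path of the complete graph on `Fin n`:
it is the path graph on `n` vertices up to a relabeling of the vertices. -/
def IsHamPathGraph {n : ℕ} (H : SimpleGraph (Fin n)) : Prop :=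
  ∃ σ : Equiv.Perm (Fin n), ∀ a b, H.Adj a b ↔ (pathGraph n).Adj (σ a) (σ b)

/-- The maximum size of a family of Hamiltonian paths of `K_n` that are
pairwise `C_k`-creating. -/
noncomputable def Hnum (n k : ℕ) : ℕ :=
  sSup {m | ∃ F : Finset (SimpleGraph (Fin n)), F.card = m ∧
    (∀ G ∈ F, IsHamPathGraph G) ∧
    ∀ G₁ ∈ F, ∀ G₂ ∈ F, G₁ ≠ G₂ → ContainsCycleLen (G₁ ⊔ G₂) k}

/-- `H` is a perfect matching (as a graph): every vertex has a unique neighbor. -/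
def IsPMGraph {V : Type*} (H : SimpleGraph V) : Prop :=
  ∀ v : V, ∃! w : V, H.Adj v w

/-- The maximum size of a family of perfect matchings of `K_n` that are
pairwise `C_k`-creating. -/
noncomputable def Mnum (n k : ℕ) : ℕ :=
  sSup {m | ∃ F : Finset (SimpleGraph (Fin n)), F.card = m ∧
    (∀ G ∈ F, IsPMGraph G) ∧
    ∀ G₁ ∈ F, ∀ G₂ ∈ F, G₁ ≠ G₂ → ContainsCycleLen (G₁ ⊔ G₂) k}

section GroupConstruction
open Polynomial

/-- Matrices `(a b; c d)` in `SL₂(F[X])` that are upper unitriangular modulo `X`. -/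
@[ext] structure Gm (F : Type) [Field F] where
  a : F[X]
  b : F[X]
  c : F[X]
  d : F[X]
  det : a * d - b * c = 1
  ha : X ∣ a - 1
  hc : X ∣ c
  hd : X ∣ d - 1

namespace Gm
variable {F : Type} [Field F]

noncomputable instance : Mul (Gm F) where
  mul M N :=
    { a := M.a * N.a + M.b * N.c
      b := M.a * N.b + M.b * N.d
      c := M.c * N.a + M.d * N.c
      d := M.c * N.b + M.d * N.d
      det := by linear_combination (N.a * N.d - N.b * N.c) * M.det + N.det
      ha := by
        have : M.a * N.a + M.b * N.c - 1 = (M.a - 1) * N.a + (N.a - 1) + N.c * M.b := by ring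
        rw [this]
        exact dvd_add (dvd_add (M.ha.mul_right _) N.ha) (N.hc.mul_right _)
      hc := dvd_add (M.hc.mul_right _) (N.hc.mul_left _)
      hd := by
        have : M.c * N.b + M.d * N.d - 1 = (M.d - 1) * N.d + (N.d - 1) + M.c * N.b := by ring
        rw [this]
        exact dvd_add (dvd_add (M.hd.mul_right _) N.hd) (M.hc.mul_right _) }

noncomputable instance : One (Gm F) where
  one := ⟨1, 0, 0, 1, by ring, by simp, by simp, by simp⟩

noncomputable instance : Inv (Gm F) where
  inv M := ⟨M.d, -M.b, -M.c, M.a, by linear_combination M.det, M.hd, by simpa using M.hc, M.ha⟩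

@[simp] lemma mul_a (M N : Gm F) : (M * N).a = M.a * N.a + M.b * N.c := rfl
@[simp] lemma mul_b (M N : Gm F) : (M * N).b = M.a * N.b + M.b * N.d := rfl
@[simp] lemma mul_c (M N : Gm F) : (M * N).c = M.c * N.a + M.d * N.c := rfl
@[simp] lemma mul_d (M N : Gm F) : (M * N).d = M.c * N.b + M.d * N.d := rfl
@[simp] lemma one_a : (1 : Gm F).a = 1 := rfl
@[simp] lemma one_b : (1 : Gm F).b = 0 := rfl
@[simp] lemma one_c : (1 : Gm F).c = 0 := rfl
@[simp] lemma one_d : (1 : Gm F).d = 1 := rfl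
@[simp] lemma inv_a (M : Gm F) : M⁻¹.a = M.d := rfl
@[simp] lemma inv_b (M : Gm F) : M⁻¹.b = -M.b := rfl
@[simp] lemma inv_c (M : Gm F) : M⁻¹.c = -M.c := rfl
@[simp] lemma inv_d (M : Gm F) : M⁻¹.d = M.a := rfl

noncomputable instance : Group (Gm F) :=
  Group.ofLeftAxioms
    (by intro x y z; ext1 <;> simp <;> ring)
    (by intro x; ext1 <;> simp)
    (by intro x; have := x.det; ext1 <;> simp <;> first | linear_combination this | ring)

/-- A congruence subgroup. -/
def NN (F : Type) [Field F] (u w : ℕ) (_hw : w ≤ u + 1) : Subgroup (Gm F) where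
  carrier := {M | (X : F[X])^(u+1) ∣ M.a - 1 ∧ (X : F[X])^w ∣ M.b ∧
    (X : F[X])^(u+1) ∣ M.c ∧ (X : F[X])^(u+1) ∣ M.d - 1}
  one_mem' := by simp
  mul_mem' := by
    rintro M M' ⟨ha, hb, hc, hd⟩ ⟨ha', hb', hc', hd'⟩
    refine ⟨?_, ?_, ?_, ?_⟩
    · have : (M * M').a - 1 = (M.a - 1) * M'.a + (M'.a - 1) + M'.c * M.b := by simp; ring
      rw [this]
      exact dvd_add (dvd_add (ha.mul_right _) ha') (hc'.mul_right _)
    · exact dvd_add (hb'.mul_left _) (hb.mul_right _)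
    · exact dvd_add (hc.mul_right _) (hc'.mul_left _)
    · have : (M * M').d - 1 = (M.d - 1) * M'.d + (M'.d - 1) + M.c * M'.b := by simp; ring
      rw [this]
      exact dvd_add (dvd_add (hd.mul_right _) hd') (hc.mul_right _)
  inv_mem' := by
    rintro M ⟨h1, h2, h3, h4⟩
    exact ⟨h4, by simpa using h2, by simpa using h3, h1⟩

lemma mem_NN {u w : ℕ} {hw : w ≤ u + 1} {M : Gm F} : M ∈ NN F u w hw ↔
    (X : F[X])^(u+1) ∣ M.a - 1 ∧ (X : F[X])^w ∣ M.b ∧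
    (X : F[X])^(u+1) ∣ M.c ∧ (X : F[X])^(u+1) ∣ M.d - 1 := Iff.rfl

lemma NN_normal (u w : ℕ) (hw : w ≤ u + 1) (hu : u ≤ w) : (NN F u w hw).Normal := by
  constructor
  intro n hn g
  obtain ⟨h1, h2, h3, h4⟩ := hn
  have hc := g.hc
  have hdet := g.det
  have hp : (X : F[X])^w ∣ X^(u+1) := pow_dvd_pow _ hw
  have hbc : (X : F[X])^(u+1) ∣ n.b * g.c :=
    (pow_dvd_pow _ (by omega : u + 1 ≤ w + 1)).trans (by rw [pow_succ]; exact mul_dvd_mul h2 hc)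
  rw [mem_NN]
  refine ⟨?_, ?_, ?_, ?_⟩
  · have : (g * n * g⁻¹).a - 1
      = (n.a - 1) * (g.a * g.d) + n.c * (g.b * g.d) - (n.b * g.c) * g.a - (n.d - 1) * (g.b * g.c) := by
      simp; linear_combination hdet
    rw [this]
    exact dvd_sub (dvd_sub (dvd_add (h1.mul_right _) (h3.mul_right _)) (hbc.mul_right _)) (h4.mul_right _)
  · have : (g * n * g⁻¹).b
      = (n.d - 1) * (g.a * g.b) - (n.a - 1) * (g.a * g.b) + n.b * (g.a * g.a) - n.c * (g.b * g.b) := by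
      simp; ring
    rw [this]
    exact dvd_sub (dvd_add (dvd_sub ((hp.trans h4).mul_right _) ((hp.trans h1).mul_right _)) (h2.mul_right _)) ((hp.trans h3).mul_right _)
  · have : (g * n * g⁻¹).c
      = (n.a - 1) * (g.c * g.d) + n.c * (g.d * g.d) - (n.b * g.c) * g.c - (n.d - 1) * (g.c * g.d) := by
      simp; ring
    rw [this]
    exact dvd_sub (dvd_sub (dvd_add (h1.mul_right _) (h3.mul_right _)) (hbc.mul_right _)) (h4.mul_right _)
  · have : (g * n * g⁻¹).d - 1
      = (n.b * g.c) * g.a - n.c * (g.b * g.d) + (n.d - 1) * (g.a * g.d) - (n.a - 1) * (g.b * g.c) := by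
      simp; linear_combination hdet
    rw [this]
    exact dvd_sub (dvd_add (dvd_sub (hbc.mul_right _) (h3.mul_right _)) (h4.mul_right _)) (h1.mul_right _)

lemma NN_trace (u w k : ℕ) (hw : w ≤ u + 1) (hk : k + 1 ≤ u + 1 + w)
    (hk2 : k + 1 ≤ 2 * (u + 1)) (n : Gm F) (hn : n ∈ NN F u w hw) :
    (X : F[X])^(k+1) ∣ n.a + n.d - 2 := by
  obtain ⟨h1, h2, h3, h4⟩ := hn
  have e : n.a + n.d - 2 = n.b * n.c - (n.a - 1) * (n.d - 1) := by
    linear_combination n.det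
  rw [e]
  refine dvd_sub ((pow_dvd_pow _ hk).trans ?_) ((pow_dvd_pow _ hk2).trans ?_)
  · rw [pow_add, mul_comm n.b]; exact mul_dvd_mul h3 h2
  · rw [two_mul, pow_add]; exact mul_dvd_mul h1 h4

noncomputable def XA : Multiplicative F →* Gm F where
  toFun a := ⟨1, C a.toAdd, 0, 1, by simp, by simp, by simp, by simp⟩
  map_one' := by ext1 <;> simp
  map_mul' := by intro a b; ext1 <;> simp [add_comm]

noncomputable def YB : Multiplicative F →* Gm F where
  toFun b := ⟨1, 0, C b.toAdd * X, 1, by simp, by simp, by simp, by simp⟩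
  map_one' := by ext1 <;> simp
  map_mul' := by intro a b; ext1 <;> simp [add_mul]

lemma word_coeff (a b : ℕ → Multiplicative F) (ha : ∀ i, a i ≠ 1) (hb : ∀ i, b i ≠ 1)
    (W : ℕ → Gm F) (h0 : W 0 = 1)
    (hs : ∀ i, W (i+1) = W i * YB (b i) * XA (a i)) (j : ℕ) :
    (∀ i, j ≤ i → 1 ≤ i → (W j).a.coeff i = 0) ∧
    (∀ i, j ≤ i → (W j).b.coeff i = 0) ∧
    (∀ i, j < i → (W j).c.coeff i = 0) ∧
    (∀ i, j < i → (W j).d.coeff i = 0) ∧ (W j).d.coeff j ≠ 0 := by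
  induction j with
  | zero =>
    rw [h0]
    refine ⟨?_, ?_, ?_, ?_, ?_⟩
    · intro i _ hi; simp [coeff_one]; omega
    · simp
    · simp
    · intro i hi; simp [coeff_one]; omega
    · simp
  | succ j ih =>
    obtain ⟨h1, h2, h3, h4, h5⟩ := ih
    have hs := hs j
    have ha : (a j).toAdd ≠ 0 := ha j
    have hb : (b j).toAdd ≠ 0 := hb j
    generalize W (j+1) = W' at *
    have e00 : W'.a = (W j).a + C (b j).toAdd * ((W j).b * X) := by
      rw [hs]; simp [XA, YB]; ring
    have e01 : W'.b = C (a j).toAdd * (W j).a + (W j).b + C ((a j).toAdd * (b j).toAdd) * ((W j).b * X) := by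
      rw [hs]; simp [XA, YB]; ring
    have e10 : W'.c = (W j).c + C (b j).toAdd * ((W j).d * X) := by
      rw [hs]; simp [XA, YB]; ring
    have e11 : W'.d = C (a j).toAdd * (W j).c + (W j).d + C ((a j).toAdd * (b j).toAdd) * ((W j).d * X) := by
      rw [hs]; simp [XA, YB]; ring
    refine ⟨?_, ?_, ?_, ?_, ?_⟩
    · intro i hi _
      obtain ⟨i, rfl⟩ : ∃ i', i = i' + 1 := ⟨i - 1, by omega⟩
      rw [e00, coeff_add, coeff_C_mul, coeff_mul_X, h1 _ (by omega) (by omega), h2 _ (by omega)]; simp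
    · intro i hi
      obtain ⟨i, rfl⟩ : ∃ i', i = i' + 1 := ⟨i - 1, by omega⟩
      rw [e01, coeff_add, coeff_add, coeff_C_mul, coeff_C_mul, coeff_mul_X,
        h1 _ (by omega) (by omega), h2 _ (by omega), h2 _ (by omega)]; simp
    · intro i hi
      obtain ⟨i, rfl⟩ : ∃ i', i = i' + 1 := ⟨i - 1, by omega⟩
      rw [e10, coeff_add, coeff_C_mul, coeff_mul_X, h3 _ (by omega), h4 _ (by omega)]; simp
    · intro i hi
      obtain ⟨i, rfl⟩ : ∃ i', i = i' + 1 := ⟨i - 1, by omega⟩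
      rw [e11, coeff_add, coeff_add, coeff_C_mul, coeff_C_mul, coeff_mul_X,
        h3 _ (by omega), h4 _ (by omega), h4 _ (by omega)]; simp
    · rw [e11, coeff_add, coeff_add, coeff_C_mul, coeff_C_mul, coeff_mul_X,
        h3 _ (by omega), h4 _ (by omega)]
      simp only [mul_zero, zero_add]
      exact mul_ne_zero (mul_ne_zero ha hb) h5

lemma word_not_mem (u w k : ℕ) (hw : w ≤ u + 1) (hk : k + 1 ≤ u + 1 + w)
    (hk2 : k + 1 ≤ 2 * (u + 1)) (hk1 : 1 ≤ k)
    (a b : ℕ → Multiplicative F) (ha : ∀ i, a i ≠ 1) (hb : ∀ i, b i ≠ 1)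
    (W : ℕ → Gm F) (h0 : W 0 = 1)
    (hs : ∀ i, W (i+1) = W i * YB (b i) * XA (a i)) : W k ∉ NN F u w hw := by
  intro hn
  have h := NN_trace u w k hw hk hk2 _ hn
  obtain ⟨h1, -, -, -, h5⟩ := word_coeff a b ha hb W h0 hs k
  rw [X_pow_dvd_iff] at h
  have := h k (by omega)
  rw [coeff_sub, coeff_add, h1 k le_rfl hk1] at this
  have h2 : (2 : F[X]).coeff k = 0 := by
    rw [show (2 : F[X]) = C 2 from (map_ofNat C 2).symm, coeff_C, if_neg (by omega)]
  rw [h2] at this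
  apply h5; simpa using this

/-- coefficient data -/
def code (u w : ℕ) (M : Gm F) : (Fin u → F) × (Fin w → F) × (Fin u → F) :=
  (fun i => M.a.coeff (i + 1), fun i => M.b.coeff i, fun i => M.c.coeff (i + 1))

lemma code_inj (u w : ℕ) (hw : w ≤ u + 1) (hu : u ≤ w) (M M' : Gm F)
    (h : code u w M = code u w M') : M' * M⁻¹ ∈ NN F u w hw := by
  simp only [code, Prod.mk.injEq, funext_iff] at h
  obtain ⟨h1, h2, h3⟩ := h
  have hp : (X : F[X])^w ∣ X^(u+1) := pow_dvd_pow _ hw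
  have da : (X : F[X])^(u+1) ∣ M'.a - M.a := by
    rw [X_pow_dvd_iff]
    intro i hi
    rcases i with _ | i
    · have e1 := M.ha; have e2 := M'.ha
      rw [X_dvd_iff] at e1 e2
      simp only [coeff_sub] at e1 e2 ⊢
      linear_combination e2 - e1
    · have := h1 ⟨i, by omega⟩
      simp only at this
      simp [this]
  have db : (X : F[X])^w ∣ M'.b - M.b := by
    rw [X_pow_dvd_iff]
    intro i hi
    have := h2 ⟨i, hi⟩
    simp only at this
    simp [this]
  have dc : (X : F[X])^(u+1) ∣ M'.c - M.c := by
    rw [X_pow_dvd_iff]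
    intro i hi
    rcases i with _ | i
    · have e1 := M.hc; have e2 := M'.hc
      rw [X_dvd_iff] at e1 e2
      simp only [coeff_sub] at e1 e2 ⊢
      linear_combination e2 - e1
    · have := h3 ⟨i, by omega⟩
      simp only at this
      simp [this]
  have dbc : (X : F[X])^(u+1) ∣ (M'.b - M.b) * M.c :=
    (pow_dvd_pow _ (by omega : u + 1 ≤ w + 1)).trans (by rw [pow_succ]; exact mul_dvd_mul db M.hc)
  have dd : (X : F[X])^(u+1) ∣ M'.d - M.d := by
    have hcop : IsCoprime ((X : F[X])^(u+1)) M.a := by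
      apply IsCoprime.pow_left
      obtain ⟨z, hz⟩ := M.ha
      exact ⟨-z, 1, by linear_combination hz⟩
    apply hcop.dvd_of_dvd_mul_left
    have : M.a * (M'.d - M.d) = (M'.b - M.b) * M.c + (M'.c - M.c) * M'.b - (M'.a - M.a) * M'.d := by
      linear_combination M'.det - M.det
    rw [this]
    exact dvd_sub (dvd_add dbc (dc.mul_right _)) (da.mul_right _)
  rw [mem_NN]
  have hdet := M.det
  refine ⟨?_, ?_, ?_, ?_⟩
  · have : (M' * M⁻¹).a - 1 = (M'.a - M.a) * M.d - (M'.b - M.b) * M.c := by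
      simp; linear_combination hdet
    rw [this]; exact dvd_sub (da.mul_right _) dbc
  · have : (M' * M⁻¹).b = (M'.b - M.b) * M.a - (M'.a - M.a) * M.b := by
      simp; ring
    rw [this]; exact dvd_sub (db.mul_right _) ((hp.trans da).mul_right _)
  · have : (M' * M⁻¹).c = (M'.c - M.c) * M.d - (M'.d - M.d) * M.c := by
      simp; ring
    rw [this]; exact dvd_sub (dc.mul_right _) (dd.mul_right _)
  · have : (M' * M⁻¹).d - 1 = (M'.d - M.d) * M.a - (M'.c - M.c) * M.b := by
      simp; linear_combination hdet
    rw [this]; exact dvd_sub (dd.mul_right _) (dc.mul_right _)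

end Gm

/-- The group used in the construction. -/
lemma exists_group (k q : ℕ) (hk : 2 ≤ k) (hq : q.Prime) :
    ∃ (G : Type) (_ : Group G) (_ : Finite G) (A B : Subgroup G),
      Nat.card A = q ∧ Nat.card B = q ∧ Nat.card G ≤ q ^ (k + k / 2) ∧ A ⊓ B = ⊥ ∧
      ∀ (a b x : ℕ → G), (∀ i, a i ∈ A ∧ a i ≠ 1 ∧ b i ∈ B ∧ b i ≠ 1) →
        (∀ i, x (i + 1) = x i * b i * a i) → x k ≠ x 0 := by
  have : Fact q.Prime := ⟨hq⟩
  let F := ZMod q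
  set u := k / 2 with hu
  set w := k - k / 2 with hw
  have hw1 : w ≤ u + 1 := by omega
  have huw : u ≤ w := by omega
  have := Gm.NN_normal (F := F) u w hw1 huw
  let N := Gm.NN F u w hw1
  let π : Gm F →* Gm F ⧸ N := QuotientGroup.mk' N
  let fA : Multiplicative F →* Gm F ⧸ N := π.comp Gm.XA
  let fB : Multiplicative F →* Gm F ⧸ N := π.comp Gm.YB
  have hmem : ∀ x : Gm F, π x = 1 ↔ x ∈ N := fun x => QuotientGroup.eq_one_iff x
  have injA : Function.Injective fA := by
    rw [injective_iff_map_eq_one]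
    intro a ha
    have := (hmem _).1 ha
    obtain ⟨-, h, -⟩ := this
    rw [X_pow_dvd_iff] at h
    have := h 0 (by omega)
    simpa [Gm.XA] using this
  have injB : Function.Injective fB := by
    rw [injective_iff_map_eq_one]
    intro a ha
    have := (hmem _).1 ha
    obtain ⟨-, -, h, -⟩ := this
    rw [X_pow_dvd_iff] at h
    have := h 1 (by omega)
    simpa [Gm.YB] using this
  have hinj : Function.Injective (fun g : Gm F ⧸ N => Gm.code u w g.out) := by
    intro g g' h
    have h1 := Gm.code_inj u w hw1 huw _ _ h
    have h2 := (hmem _).2 h1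
    rw [map_mul, map_inv] at h2
    have e1 : π g.out = g := QuotientGroup.out_eq' g
    have e2 : π g'.out = g' := QuotientGroup.out_eq' g'
    rw [e1, e2, mul_inv_eq_one] at h2
    exact h2.symm
  have hcardF : Nat.card (Multiplicative F) = q := by
    rw [show Nat.card (Multiplicative F) = Nat.card (ZMod q) from rfl, Nat.card_zmod]
  refine ⟨Gm F ⧸ N, inferInstance, Finite.of_injective _ hinj, fA.range, fB.range, ?_, ?_, ?_, ?_, ?_⟩
  · exact (Nat.card_congr (MonoidHom.ofInjective injA).toEquiv.symm).trans hcardF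
  · exact (Nat.card_congr (MonoidHom.ofInjective injB).toEquiv.symm).trans hcardF
  · refine (Nat.card_le_card_of_injective _ hinj).trans (le_of_eq ?_)
    rw [Nat.card_prod, Nat.card_prod, Nat.card_fun, Nat.card_fun, Nat.card_eq_fintype_card,
      Nat.card_eq_fintype_card, Nat.card_eq_fintype_card, Fintype.card_fin, Fintype.card_fin, ZMod.card, ← pow_add, ← pow_add]
    congr 1; omega
  · rw [eq_bot_iff]
    rintro g ⟨⟨a, rfl⟩, ⟨b, hb⟩⟩
    rw [Subgroup.mem_bot]
    have h1 : π (Gm.XA a * (Gm.YB b)⁻¹) = 1 := by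
      rw [map_mul, map_inv, mul_inv_eq_one]; exact hb.symm
    obtain ⟨-, h, -⟩ := (hmem _).1 h1
    rw [X_pow_dvd_iff] at h
    have := h 0 (by omega)
    have ha : a = 1 := by simpa [Gm.XA, Gm.YB] using this
    rw [ha, map_one]
  · intro a b x h hx
    choose hA ha1 hB hb1 using h
    choose α hα using hA
    choose β hβ using hB
    let W : ℕ → Gm F := fun n => Nat.rec 1 (fun i r => r * Gm.YB (β i) * Gm.XA (α i)) n
    have hxW : ∀ i, x i = x 0 * π (W i) := by
      intro i
      induction i with
      | zero => simp [W]
      | succ i ih =>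
        rw [hx, ih, ← hα, ← hβ]
        simp only [W, map_mul, mul_assoc]
        rfl
    intro hk0
    rw [hxW k] at hk0
    have h1 : π (W k) = 1 := by simpa using hk0
    refine Gm.word_not_mem u w k hw1 (by omega) (by omega) (by omega) α β ?_ ?_ W rfl
      (fun i => rfl) ((hmem _).1 h1)
    · intro i hi; apply ha1 i; rw [← hα, hi, map_one]
    · intro i hi; apply hb1 i; rw [← hβ, hi, map_one]

end GroupConstruction

section Counting
open Finset

lemma pow_self_le (D : ℕ) : D ^ D ≤ 3 ^ D * D.factorial := by
  have h := Real.pow_div_factorial_le_exp (x := (D:ℝ)) (by positivity) D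
  rw [div_le_iff₀ (by positivity)] at h
  have h3 : Real.exp D ≤ 3 ^ D := by
    have := Real.exp_one_lt_d9
    calc Real.exp D = Real.exp 1 ^ D := by rw [← Real.exp_nat_mul, mul_one]
      _ ≤ 3 ^ D := pow_le_pow_left₀ (Real.exp_pos _).le (by linarith) _
  have : (D:ℝ)^D ≤ 3 ^ D * D.factorial := h.trans (by gcongr)
  exact_mod_cast this

variable {X R : Type} [Fintype X] [Fintype R] [DecidableEq X] [DecidableEq R]

lemma exists_rank (r : X → R) :
    ∃ rk : X → ℕ, (∀ x, rk x < #{y | r y = r x}) ∧ Function.Injective (fun x => (r x, rk x)) := by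
  classical
  let E : ∀ w : R, {y // y ∈ univ.filter (fun y => r y = w)} ≃ Fin (#{y | r y = w}) :=
    fun w => Finset.equivFin _
  refine ⟨fun x => (E (r x) ⟨x, by simp⟩ : ℕ), fun x => (E (r x) ⟨x, by simp⟩).2, ?_⟩
  have key : ∀ w x x' (hx : r x = w) (hx' : r x' = w),
      (E w ⟨x, by simp [hx]⟩ : ℕ) = E w ⟨x', by simp [hx']⟩ → x = x' := by
    intro w x x' hx hx' h
    have := (E w).injective (Fin.ext h)
    simpa using this
  intro x x' h
  simp only [Prod.mk.injEq] at h
  obtain ⟨h1, h2⟩ := h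
  refine key (r x') x x' h1 rfl ?_
  rw [← h2]
  have : ∀ w (hw : r x = w), (E w ⟨x, by simp [hw]⟩ : ℕ) = E (r x) ⟨x, by simp⟩ := by
    intro w hw; subst hw; rfl
  exact this _ h1

lemma count_main (d' d : ℕ) (ρ : X → Fin d' → R)
    (hfib : ∀ w, #{e : X × Fin d' | ρ e.1 e.2 = w} ≤ d) :
    ∃ (j : X × Fin d' → ℕ) (T : Finset (R × ℕ)) (S : Finset (X → Fin d')),
      (∀ f ∈ S, Function.Injective (fun x => (ρ x (f x), j (x, f x))) ∧
        univ.image (fun x => (ρ x (f x), j (x, f x))) = T) ∧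
      d' ^ (2 * Fintype.card X) ≤ (d + 1) ^ (2 * Fintype.card R) * (3 * d) ^ Fintype.card X * #S := by
  classical
  -- degrees
  have hdeg : ∀ (f : X → Fin d') w, #{x | ρ x (f x) = w} ≤ d := by
    intro f w
    refine le_trans ?_ (hfib w)
    apply Finset.card_le_card_of_injOn (fun x => (x, f x))
    · intro x hx; simpa using hx
    · intro x _ y _ h; simpa using (Prod.mk.inj h).1
  let deg : (X → Fin d') → (R → Fin (d+1)) := fun f w => ⟨#{x | ρ x (f x) = w}, by have := hdeg f w; omega⟩
  obtain ⟨D, hD⟩ : ∃ D : R → Fin (d+1), d' ^ Fintype.card X ≤ (d+1)^Fintype.card R * #{f | deg f = D} := by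
    by_contra! hcon
    have h1 : (univ : Finset (X → Fin d')).card = ∑ D : R → Fin (d+1), #{f | deg f = D} :=
      Finset.card_eq_sum_card_fiberwise (fun f _ => by simp)
    have h2 : (univ : Finset (X → Fin d')).card = d' ^ Fintype.card X := by simp
    have hc : Fintype.card (R → Fin (d+1)) = (d+1)^Fintype.card R := by simp
    have h3 : ∑ D : R → Fin (d+1), ((d+1)^Fintype.card R * #{f | deg f = D}) <
        ∑ D : R → Fin (d+1), d' ^ Fintype.card X :=
      Finset.sum_lt_sum_of_nonempty univ_nonempty (fun D _ => hcon D)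
    rw [← Finset.mul_sum, ← h1, h2, Finset.sum_const, card_univ, hc, smul_eq_mul] at h3
    exact lt_irrefl _ h3
  set Φ : Finset (X → Fin d') := {f | deg f = D} with hΦ
  have hΦd : ∀ f ∈ Φ, ∀ w, #{x | ρ x (f x) = w} = D w := by
    intro f hf w
    have : deg f = D := by simpa [hΦ] using hf
    rw [← this]
  by_cases hne : Φ.Nonempty
  swap
  · rw [not_nonempty_iff_eq_empty] at hne
    refine ⟨fun _ => 0, ∅, ∅, by simp, ?_⟩
    rw [hne] at hD
    simp only [card_empty, mul_zero, nonpos_iff_eq_zero] at hD ⊢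
    rw [mul_comm, pow_mul, hD]; simp
  set P : ℕ := ∏ w, (D w : ℕ) ^ (D w : ℕ) with hP
  have hsumD : ∑ w, (D w : ℕ) = Fintype.card X := by
    obtain ⟨f, hf⟩ := hne
    rw [← card_univ, Finset.card_eq_sum_card_fiberwise (f := fun x => ρ x (f x)) (t := univ) (fun f _ => by simp)]
    exact Finset.sum_congr rfl (fun w _ => (hΦd f hf w).symm)
  -- upper bound for Φ
  have hup : #Φ * ∏ w, (D w : ℕ).factorial ≤ d ^ Fintype.card X := by
    have h1 : #Φ ≤ #(Fintype.piFinset (fun w : R =>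
        powersetCard (D w : ℕ) ({e : X × Fin d' | ρ e.1 e.2 = w} : Finset (X × Fin d')))) := by
      apply Finset.card_le_card_of_injOn
        (fun f w => ({e : X × Fin d' | ρ e.1 e.2 = w ∧ e.2 = f e.1} : Finset (X × Fin d')))
      · intro f hf
        simp only [Finset.mem_coe, Fintype.mem_piFinset, mem_powersetCard]
        intro w
        refine ⟨?_, ?_⟩
        · intro e he; simp at he ⊢; exact he.1
        · rw [← hΦd f hf w]
          symm
          apply Finset.card_bij (fun x _ => (x, f x))
          · intro x hx; simpa using hx
          · intro x _ y _ h; simpa using (Prod.mk.inj h).1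
          · rintro ⟨x, c⟩ he
            simp at he
            exact ⟨x, by simp [← he.2, he.1], by simp [he.2]⟩
      · intro f _ f' _ h
        funext x
        have h2 := congrFun h (ρ x (f x))
        simp only at h2
        have h3 : (x, f x) ∈ ({e : X × Fin d' | ρ e.1 e.2 = ρ x (f x) ∧ e.2 = f' e.1} : Finset (X × Fin d')) := by
          rw [← h2]; simp
        simp at h3
        exact h3
    rw [Fintype.card_piFinset] at h1
    calc #Φ * ∏ w, (D w : ℕ).factorial
        ≤ (∏ w, #(powersetCard (D w : ℕ) ({e : X × Fin d' | ρ e.1 e.2 = w} : Finset (X × Fin d')))) * ∏ w, (D w : ℕ).factorial := by gcongr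
      _ = ∏ w, #(powersetCard (D w : ℕ) ({e : X × Fin d' | ρ e.1 e.2 = w} : Finset (X × Fin d'))) * (D w : ℕ).factorial := by
          rw [Finset.prod_mul_distrib]
      _ ≤ ∏ w, d ^ (D w : ℕ) := by
          apply Finset.prod_le_prod'
          intro w _
          rw [card_powersetCard, mul_comm, ← Nat.descFactorial_eq_factorial_mul_choose]
          exact (Nat.descFactorial_le_pow _ _).trans (Nat.pow_le_pow_left (hfib w) _)
      _ = d ^ Fintype.card X := by rw [Finset.prod_pow_eq_pow_sum, hsumD]
  have hup2 : #Φ * P ≤ (3 * d) ^ Fintype.card X := by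
    have hP3 : P ≤ 3 ^ Fintype.card X * ∏ w, (D w : ℕ).factorial := by
      rw [← hsumD, ← Finset.prod_pow_eq_pow_sum, ← Finset.prod_mul_distrib]
      exact Finset.prod_le_prod' (fun w _ => pow_self_le _)
    calc #Φ * P ≤ #Φ * (3 ^ Fintype.card X * ∏ w, (D w : ℕ).factorial) := by gcongr
      _ = 3 ^ Fintype.card X * (#Φ * ∏ w, (D w : ℕ).factorial) := by ring
      _ ≤ 3 ^ Fintype.card X * d ^ Fintype.card X := by gcongr
      _ = _ := by rw [mul_pow]
  -- labels
  let J : Finset (X × Fin d' → ℕ) := Fintype.piFinset (fun e => range (max 1 (D (ρ e.1 e.2))))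
  let valid : (X × Fin d' → ℕ) → (X → Fin d') → Prop := fun j f =>
    Function.Injective (fun x => (ρ x (f x), j (x, f x)))
  have hJpos : 0 < #J := by
    rw [Fintype.card_piFinset]
    exact Finset.prod_pos (fun e _ => by simp)
  have hval : ∀ f ∈ Φ, #J ≤ P * #{j ∈ J | valid j f} := by
    intro f hf
    obtain ⟨rk, hrk1, hrk2⟩ := exists_rank (fun x => ρ x (f x))
    have hrk1 : ∀ x, rk x < D (ρ x (f x)) := fun x => by
      have := hrk1 x
      rwa [hΦd f hf] at this
    let J' : Finset (X × Fin d' → ℕ) := Fintype.piFinset (fun e =>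
      if e.2 = f e.1 then {rk e.1} else range (max 1 (D (ρ e.1 e.2))))
    have hsub : J' ⊆ ({j ∈ J | valid j f} : Finset _) := by
      intro j hj
      rw [Fintype.mem_piFinset] at hj
      have hj1 : ∀ x, j (x, f x) = rk x := fun x => by simpa using hj (x, f x)
      rw [mem_filter]
      refine ⟨?_, ?_⟩
      · rw [Fintype.mem_piFinset]
        rintro ⟨x, c⟩
        by_cases hc : c = f x
        · subst hc
          rw [hj1 x, mem_range]
          exact lt_max_of_lt_right (hrk1 x)
        · simpa [hc] using hj (x, c)
      · simp only [valid, hj1]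
        exact hrk2
    have hPx : P = ∏ x, max 1 (D (ρ x (f x)) : ℕ) := by
      rw [← Finset.prod_fiberwise' univ (fun x => ρ x (f x)) (fun w => max 1 (D w : ℕ))]
      apply Finset.prod_congr rfl
      intro w _
      rw [Finset.prod_const, hΦd f hf]
      rcases Nat.eq_zero_or_pos (D w : ℕ) with h | h
      · rw [h]; simp
      · rw [max_eq_right h]
    calc #J = ∏ x, ∏ c, max 1 (D (ρ x c) : ℕ) := by
          rw [Fintype.card_piFinset, Fintype.prod_prod_type]; simp
      _ = ∏ x, (max 1 (D (ρ x (f x)) : ℕ) * ∏ c, if c = f x then 1 else max 1 (D (ρ x c) : ℕ)) := by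
          apply Finset.prod_congr rfl
          intro x _
          rw [← Finset.mul_prod_erase univ _ (mem_univ (f x)),
            ← Finset.mul_prod_erase univ (fun c => if c = f x then 1 else max 1 (D (ρ x c) : ℕ)) (mem_univ (f x))]
          simp only [if_true, one_mul]
          congr 1
          apply Finset.prod_congr rfl
          intro c hc
          rw [if_neg (ne_of_mem_erase hc)]
      _ = P * #J' := by
          rw [Finset.prod_mul_distrib, ← hPx, Fintype.card_piFinset, Fintype.prod_prod_type]
          congr 1
          apply Finset.prod_congr rfl
          intro x _
          apply Finset.prod_congr rfl
          intro c _
          simp only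
          split_ifs <;> simp
      _ ≤ _ := by gcongr
  -- double counting
  obtain ⟨j, hjJ, hj⟩ : ∃ j ∈ J, #Φ ≤ P * #{f ∈ Φ | valid j f} := by
    by_contra! hcon
    have h1 : ∑ j ∈ J, P * #{f ∈ Φ | valid j f} < ∑ j ∈ J, #Φ :=
      Finset.sum_lt_sum_of_nonempty (card_pos.1 hJpos) hcon
    have h2 : ∑ j ∈ J, #{f ∈ Φ | valid j f} = ∑ f ∈ Φ, #{j ∈ J | valid j f} :=
      Finset.sum_card_bipartiteAbove_eq_sum_card_bipartiteBelow valid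
    rw [← Finset.mul_sum, h2, Finset.mul_sum, Finset.sum_const, smul_eq_mul] at h1
    have h3 : ∑ f ∈ Φ, #J ≤ ∑ f ∈ Φ, P * #{j ∈ J | valid j f} := Finset.sum_le_sum hval
    rw [Finset.sum_const, smul_eq_mul, mul_comm] at h3
    omega
  refine ⟨j, univ.biUnion (fun w : R => (range (D w)).image (fun i => (w, i))), {f ∈ Φ | valid j f}, ?_, ?_⟩
  · intro f hf
    rw [mem_filter] at hf
    obtain ⟨hf, hv⟩ := hf
    refine ⟨hv, ?_⟩
    apply Finset.eq_of_subset_of_card_le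
    · intro p hp
      rw [mem_image] at hp
      obtain ⟨x, -, rfl⟩ := hp
      simp only [mem_biUnion, mem_univ, true_and, mem_image, mem_range, Prod.mk.injEq]
      refine ⟨_, _, ?_, rfl, rfl⟩
      have h1 : 0 < (D (ρ x (f x)) : ℕ) := by
        rw [← hΦd f hf, card_pos]; exact ⟨x, by simp⟩
      rw [Fintype.mem_piFinset] at hjJ
      have := hjJ (x, f x)
      rw [mem_range, max_eq_right h1] at this
      exact this
    · rw [Finset.card_image_of_injective _ hv, card_univ, ← hsumD]
      refine Finset.card_biUnion_le.trans (Finset.sum_le_sum fun w _ => ?_)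
      exact Finset.card_image_le.trans (by simp)
  · calc d' ^ (2 * Fintype.card X) = (d' ^ Fintype.card X) ^ 2 := by rw [mul_comm, pow_mul]
      _ ≤ ((d+1)^Fintype.card R * #Φ)^2 := by gcongr
      _ = (d+1)^(2 * Fintype.card R) * (#Φ * #Φ) := by ring
      _ ≤ (d+1)^(2 * Fintype.card R) * (#Φ * (P * #{f ∈ Φ | valid j f})) := by gcongr
      _ = (d+1)^(2 * Fintype.card R) * (#Φ * P) * #{f ∈ Φ | valid j f} := by ring
      _ ≤ _ := by gcongr

/-- `S` is a family of permutations with no quotient having a `k`-cycle. -/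
def GoodFam {X : Type} (k : ℕ) (S : Finset (Equiv.Perm X)) : Prop :=
  ∀ g ∈ S, ∀ g' ∈ S, ∀ v, ((g'⁻¹ * g) ^ k) v = v → (g'⁻¹ * g) v = v

lemma perms_of_base (k d' d : ℕ) {L : Type} (lam : X → L) (ρ : X → Fin d' → R)
    (hfib : ∀ w, #{e : X × Fin d' | ρ e.1 e.2 = w} ≤ d)
    (hinj : ∀ x, Function.Injective (ρ x))
    (hbase : ∀ x y : ℕ → X × Fin d', (∀ i, ρ (x i).1 (x i).2 = ρ (y i).1 (y i).2 ∧ x i ≠ y i ∧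
      lam (y i).1 = lam (x (i+1)).1 ∧ y i ≠ x (i+1)) → x k ≠ x 0) :
    ∃ S : Finset (Equiv.Perm X), GoodFam k S ∧
      d' ^ (2 * Fintype.card X) ≤ (d + 1) ^ (2 * Fintype.card R) * (3 * d) ^ Fintype.card X * #S := by
  classical
  obtain ⟨j, T, S, hS, hcard⟩ := count_main d' d ρ hfib
  rcases S.eq_empty_or_nonempty with rfl | ⟨f0, hf0⟩
  · exact ⟨∅, by simp [GoodFam], by simpa using hcard⟩
  have hbij : ∀ f : S, ∃ e : X ≃ T, ∀ x, (e x : R × ℕ) = (ρ x (f.1 x), j (x, f.1 x)) := by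
    rintro ⟨f, hf⟩
    obtain ⟨h1, h2⟩ := hS f hf
    refine ⟨Equiv.ofBijective (fun x => ⟨(ρ x (f x), j (x, f x)), ?_⟩) ⟨?_, ?_⟩, fun x => rfl⟩
    · rw [← h2]; exact mem_image_of_mem _ (mem_univ x)
    · intro x y h
      exact h1 (Subtype.ext_iff.1 h)
    · rintro ⟨p, hp⟩
      rw [← h2, mem_image] at hp
      obtain ⟨x, -, rfl⟩ := hp
      exact ⟨x, rfl⟩
  choose e he using hbij
  let p : S → Equiv.Perm X := fun f => (e f).trans (e ⟨f0, hf0⟩).symm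
  have hp : Function.Injective p := by
    intro f f' h
    apply Subtype.ext
    funext x
    have h1 : e f x = e f' x := by
      have := congrArg (fun q : Equiv.Perm X => q x) h
      simpa [p] using this
    have h2 := congrArg Subtype.val h1
    rw [he, he] at h2
    exact hinj x (Prod.mk.inj h2).1
  refine ⟨univ.image p, ?_, ?_⟩
  · intro g hg g' hg' v hv
    rw [mem_image] at hg hg'
    obtain ⟨f, -, rfl⟩ := hg
    obtain ⟨f', -, rfl⟩ := hg'
    by_contra hne
    set σ : Equiv.Perm X := (p f')⁻¹ * p f with hσ
    have hσe : ∀ x, e f' (σ x) = e f x := by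
      intro x
      have : p f' (σ x) = p f x := by simp [hσ]
      simpa [p] using this
    have hmove : ∀ i, σ ((σ^i) v) ≠ (σ^i) v := by
      intro i h
      apply hne
      apply (σ^i).injective
      rw [← Equiv.Perm.mul_apply, ← pow_succ, pow_succ', Equiv.Perm.mul_apply]
      exact h
    have hstep : ∀ i, (σ^(i+1)) v = σ ((σ^i) v) := by
      intro i; rw [pow_succ', Equiv.Perm.mul_apply]
    refine hbase (fun i => ((σ^i) v, f.1 ((σ^i) v))) (fun i => ((σ^(i+1)) v, f'.1 ((σ^(i+1)) v))) ?_ ?_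
    · intro i
      refine ⟨?_, ?_, rfl, ?_⟩
      · have := congrArg Subtype.val (hσe ((σ^i) v))
        rw [he, he] at this
        simp only [hstep]
        exact (Prod.mk.inj this).1.symm
      · intro h
        have := (Prod.mk.inj h).1
        rw [hstep] at this
        exact hmove i this.symm
      · intro h
        have h2 := (Prod.mk.inj h).2
        apply hmove (i+1)
        apply (e f').injective
        rw [hσe]
        apply Subtype.ext
        rw [he, he, h2]
    · simp [hv]
  · rw [Finset.card_image_of_injective _ hp, card_univ, Fintype.card_coe]
    exact hcard

end Counting

section GraphsFromPerms

lemma goodFam_pad {X Y : Type} [Fintype X] [Fintype Y] (k : ℕ)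
    (h : Fintype.card X ≤ Fintype.card Y) (S : Finset (Equiv.Perm X)) (hS : GoodFam k S) :
    ∃ S' : Finset (Equiv.Perm Y), GoodFam k S' ∧ S'.card = S.card := by
  classical
  obtain ⟨ι⟩ : Nonempty (X ↪ Y) := Function.Embedding.nonempty_of_card_le h
  let φ := Equiv.Perm.viaEmbeddingHom ι
  have hφ : Function.Injective φ := Equiv.Perm.viaEmbeddingHom_injective ι
  refine ⟨S.image φ, ?_, Finset.card_image_of_injective _ hφ⟩
  intro g hg g' hg' v hv
  rw [Finset.mem_image] at hg hg'
  obtain ⟨g, hg, rfl⟩ := hg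
  obtain ⟨g', hg', rfl⟩ := hg'
  rw [← map_inv, ← map_mul] at hv ⊢
  rw [← map_pow] at hv
  by_cases hvr : v ∈ Set.range ι
  · obtain ⟨x, rfl⟩ := hvr
    have e : ∀ τ : Equiv.Perm X, φ τ (ι x) = ι (τ x) := fun τ => Equiv.Perm.viaEmbedding_apply τ ι x
    rw [e] at hv ⊢
    rw [hS g hg g' hg' x (ι.injective hv)]
  · exact Equiv.Perm.viaEmbedding_apply_of_notMem _ ι v hvr

/-- involution swapping the two sides along `g` -/
def swapInv {X : Type} (g : Equiv.Perm X) : X ⊕ X → X ⊕ X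
  | .inl x => .inr (g x)
  | .inr y => .inl (g⁻¹ y)

lemma swapInv_swapInv {X : Type} (g : Equiv.Perm X) (v : X ⊕ X) : swapInv g (swapInv g v) = v := by
  rcases v with x | y <;> simp [swapInv]

lemma swapInv_ne {X : Type} (g : Equiv.Perm X) (v : X ⊕ X) : swapInv g v ≠ v := by
  rcases v with x | y <;> simp [swapInv]

def pmGraph {X V : Type} (ψ : V ≃ X ⊕ X) (g : Equiv.Perm X) : SimpleGraph V where
  Adj a b := ψ b = swapInv g (ψ a)
  symm := ⟨fun a b h => by rw [h, swapInv_swapInv]⟩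
  loopless := ⟨fun a h => swapInv_ne g _ h.symm⟩

lemma pm_isPM {X V : Type} (ψ : V ≃ X ⊕ X) (g : Equiv.Perm X) : IsPMGraph (pmGraph ψ g) := by
  intro v
  refine ⟨ψ.symm (swapInv g (ψ v)), ?_, ?_⟩
  · simp [pmGraph]
  · intro w hw
    rw [← (show ψ w = swapInv g (ψ v) from hw)]; simp

lemma pm_inj {X V : Type} (ψ : V ≃ X ⊕ X) : Function.Injective (pmGraph ψ) := by
  intro g g' h
  ext x
  have h1 : (pmGraph ψ g).Adj (ψ.symm (.inl x)) (ψ.symm (.inr (g x))) := by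
    simp [pmGraph, swapInv]
  rw [h] at h1
  simpa [pmGraph, swapInv] using h1

lemma alt_walk {X : Type} (μ₁ μ₂ : X → X) (hμ₁ : ∀ x, μ₁ (μ₁ x) = x) (hμ₂ : ∀ x, μ₂ (μ₂ x) = x)
    (k : ℕ) (p : ℕ → X) (hp : ∀ i, i < 2 * k → p (i+1) = μ₁ (p i) ∨ p (i+1) = μ₂ (p i))
    (hne : ∀ i, i + 2 ≤ 2 * k → p (i+2) ≠ p i) (h1 : p 1 = μ₁ (p 0)) (i : ℕ) (hi : i < k) :
    p (2 * i + 1) = μ₁ (p (2 * i)) ∧ p (2 * i + 2) = μ₂ (p (2 * i + 1)) := by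
  have aux : ∀ i, i < k → p (2 * i + 1) = μ₁ (p (2 * i)) → p (2 * i + 2) = μ₂ (p (2 * i + 1)) := by
    intro i hi h
    rcases hp (2 * i + 1) (by omega) with h2 | h2
    · exfalso
      rw [h, hμ₁] at h2
      exact hne (2 * i) (by omega) h2
    · exact h2
  induction i with
  | zero => exact ⟨h1, aux 0 hi h1⟩
  | succ i ih =>
    obtain ⟨h3, h4⟩ := ih (by omega)
    have h5 : p (2 * (i + 1) + 1) = μ₁ (p (2 * (i + 1))) := by
      rcases hp (2 * (i + 1)) (by omega) with h | h
      · exact h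
      · exfalso
        rw [show 2 * (i + 1) = 2 * i + 2 by ring] at h
        rw [h4, hμ₂] at h
        exact hne (2 * i + 1) (by omega) h
    exact ⟨h5, aux _ hi h5⟩

lemma swap_iter {X : Type} (g g' : Equiv.Perm X) (v : X ⊕ X) (k : ℕ) (p : ℕ → X ⊕ X)
    (h0 : p 0 = v) (hp : ∀ i, i < k → p (i+1) = swapInv g' (swapInv g (p i))) :
    (∀ x, v = .inl x → ∀ i, i ≤ k → p i = .inl (((g'⁻¹ * g)^i) x)) ∧
    (∀ y, v = .inr y → ∀ i, i ≤ k → p i = .inr (g' (((g⁻¹ * g')^i) (g'⁻¹ y)))) := by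
  refine ⟨?_, ?_⟩
  · intro x hx i
    induction i with
    | zero => intro _; simp [h0, hx]
    | succ i ih =>
      intro hi
      rw [hp i (by omega), ih (by omega), pow_succ']
      simp [swapInv]
  · intro x hx i
    induction i with
    | zero => intro _; simp [h0, hx]
    | succ i ih =>
      intro hi
      rw [hp i (by omega), ih (by omega), pow_succ']
      simp [swapInv]

lemma no_alt {X : Type} (k : ℕ) (hk : 2 ≤ k) (S : Finset (Equiv.Perm X)) (hS : GoodFam k S)
    (g g' : Equiv.Perm X) (hg : g ∈ S) (hg' : g' ∈ S) (p : ℕ → X ⊕ X)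
    (hp : ∀ i, i < 2 * k → p (i+1) = swapInv g (p i) ∨ p (i+1) = swapInv g' (p i))
    (hne : ∀ i, i + 2 ≤ 2 * k → p (i+2) ≠ p i) (h1 : p 1 = swapInv g (p 0))
    (hc : p (2 * k) = p 0) : False := by
  have h := alt_walk _ _ (swapInv_swapInv g) (swapInv_swapInv g') k p hp hne h1
  obtain ⟨hl, hr⟩ := swap_iter g g' (p 0) k (fun i => p (2 * i)) rfl (by
    intro i hi
    obtain ⟨h3, h4⟩ := h i hi
    rw [show 2 * (i + 1) = 2 * i + 2 by ring, h4, h3])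
  rcases hv : p 0 with x | y
  · have h2 := hl x hv k le_rfl
    have h3 := hl x hv 1 (by omega)

    rw [hc, hv, Sum.inl.injEq] at h2
    have := hS g hg g' hg' x h2.symm
    rw [pow_one, this] at h3
    exact hne 0 (by omega) (by rw [hv]; exact h3)
  · have h2 := hr y hv k le_rfl
    have h3 := hr y hv 1 (by omega)

    rw [hc, hv, Sum.inr.injEq] at h2
    have h4 : ((g⁻¹ * g') ^ k) (g'⁻¹ y) = g'⁻¹ y := by
      apply g'.injective; rw [← h2]; simp
    have := hS g' hg' g hg _ h4
    rw [pow_one, this] at h3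
    exact hne 0 (by omega) (by rw [hv]; simpa using h3)

lemma graphs_of_perms (k n h : ℕ) (hk : 2 ≤ k) (hn : n = 2 * h) (S : Finset (Equiv.Perm (Fin h)))
    (hS : GoodFam k S) : ∃ F : Finset (SimpleGraph (Fin n)),
        (∀ G ∈ F, IsPMGraph G) ∧
        (∀ G₁ ∈ F, ∀ G₂ ∈ F, G₁ ≠ G₂ → ¬ContainsCycleLen (G₁ ⊔ G₂) (2 * k)) ∧ F.card = S.card := by
  classical
  have hc : Fintype.card (Fin n) = Fintype.card (Fin h ⊕ Fin h) := by simp; omega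
  let ψ : Fin n ≃ Fin h ⊕ Fin h := Fintype.equivOfCardEq hc
  refine ⟨S.image (pmGraph ψ), ?_, ?_, Finset.card_image_of_injective _ (pm_inj ψ)⟩
  · intro G hG
    rw [Finset.mem_image] at hG
    obtain ⟨g, -, rfl⟩ := hG
    exact pm_isPM ψ g
  · intro G₁ h1 G₂ h2 _
    rw [Finset.mem_image] at h1 h2
    obtain ⟨g, hg, rfl⟩ := h1
    obtain ⟨g', hg', rfl⟩ := h2
    rintro ⟨u, w, hw, hlen⟩
    let p : ℕ → Fin h ⊕ Fin h := fun i => ψ (w.getVert i)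
    have hp : ∀ i, i < 2 * k → p (i+1) = swapInv g (p i) ∨ p (i+1) = swapInv g' (p i) := by
      intro i hi
      have := w.adj_getVert_succ (i := i) (by omega)
      rw [SimpleGraph.sup_adj] at this
      exact this
    have hinj := hw.getVert_injOn
    have h0 : w.getVert 0 = w.getVert (2 * k) := by
      rw [← hlen]; simp
    have hne : ∀ i, i + 2 ≤ 2 * k → p (i+2) ≠ p i := by
      intro i hi heq
      have heq := ψ.injective heq
      rcases Nat.eq_zero_or_pos i with rfl | hi0
      · rw [h0] at heq
        have := hinj (by simp; omega) (by simp; omega) heq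
        omega
      · have := hinj (by simp; omega) (by simp; omega) heq
        omega
    have hcl : p (2 * k) = p 0 := by simp only [p]; rw [h0]
    rcases hp 0 (by omega) with h | h
    · exact no_alt k hk S hS g g' hg hg' p hp hne h hcl
    · exact no_alt k hk S hS g' g hg' hg p (fun i hi => (hp i hi).symm) hne h hcl

end GraphsFromPerms

section Base
open Finset

lemma base_family (k q t : ℕ) (hk : 2 ≤ k) (hq : q.Prime) :
    ∃ m0 : ℕ, 0 < m0 ∧ m0 ≤ q ^ (k + k / 2 - 1) ∧ ∀ c : ℕ,
      ∃ (X : Type) (_ : Fintype X) (S : Finset (Equiv.Perm X)), GoodFam k S ∧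
        Fintype.card X = m0 * c * t ∧
        (q / t) ^ (2 * (m0 * c * t)) ≤
          (q + 1) ^ (2 * (m0 * c)) * (3 * q) ^ (m0 * c * t) * #S := by
  classical
  obtain ⟨G, _, _, A, B, hA, hB, hG, hAB, hw⟩ := exists_group k q hk hq
  have : Fintype G := Fintype.ofFinite G
  have : Fintype (G ⧸ A) := Fintype.ofFinite _
  have : Fintype (G ⧸ B) := Fintype.ofFinite _
  have hcA : Nat.card G = Nat.card (G ⧸ A) * q := by
    rw [Subgroup.card_eq_card_quotient_mul_card_subgroup A, hA]
  have hcB : Nat.card G = Nat.card (G ⧸ B) * q := by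
    rw [Subgroup.card_eq_card_quotient_mul_card_subgroup B, hB]
  have hqe : Nat.card (G ⧸ B) = Nat.card (G ⧸ A) :=
    Nat.eq_of_mul_eq_mul_right hq.pos (hcB.symm.trans hcA)
  refine ⟨Nat.card (G ⧸ A), Nat.card_pos, ?_, fun c => ?_⟩
  · have h1 : Nat.card (G ⧸ A) * q ≤ q ^ (k + k / 2 - 1) * q := by
      rw [← hcA, ← pow_succ]
      convert hG using 2
      omega
    exact Nat.le_of_mul_le_mul_right h1 hq.pos
  obtain ⟨α⟩ : Nonempty (Fin q ≃ A) := ⟨(Finite.equivFinOfCardEq hA).symm⟩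
  have hidx : ∀ (τ : Fin t) (δ : Fin (q / t)), τ.1 * (q / t) + δ.1 < q := by
    intro τ δ
    have h1 : (τ.1 + 1) * (q / t) ≤ t * (q / t) := Nat.mul_le_mul_right _ τ.2
    have h2 := Nat.mul_div_le q t
    have := δ.2
    nlinarith
  let idx : Fin t → Fin (q / t) → Fin q := fun τ δ => ⟨τ.1 * (q / t) + δ.1, hidx τ δ⟩
  have hidxinj : ∀ τ δ τ' δ', idx τ δ = idx τ' δ' → τ = τ' ∧ δ = δ' := by
    intro τ δ τ' δ' h
    have h' : τ.1 * (q / t) + δ.1 = τ'.1 * (q / t) + δ'.1 := congrArg Fin.val h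
    have hd : 0 < q / t := by have := δ.2; omega
    have e1 : τ.1 = τ'.1 := by
      have h3 := congrArg (· / (q / t)) h'
      simpa [Nat.add_div_of_dvd_right, Nat.mul_div_cancel _ hd, Nat.div_eq_of_lt δ.2,
        Nat.div_eq_of_lt δ'.2] using h3
    refine ⟨Fin.ext e1, Fin.ext ?_⟩
    rw [e1] at h'
    omega
  let X := ((G ⧸ A) × Fin c) × Fin t
  let E : X × Fin (q / t) → G := fun e => e.1.1.1.out * (α (idx e.1.2 e.2) : G)
  have hEA : ∀ e, (E e : G ⧸ A) = e.1.1.1 := by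
    intro e
    have h1 : (E e : G ⧸ A) = (e.1.1.1.out : G ⧸ A) := by
      rw [QuotientGroup.eq]
      have : (E e)⁻¹ * e.1.1.1.out = (α (idx e.1.2 e.2) : G)⁻¹ := by
        simp only [E]; group
      rw [this]; exact A.inv_mem (α _).2
    rw [h1]; exact Quotient.out_eq' _
  have hEinj : ∀ e e', e.1.1.2 = e'.1.1.2 → E e = E e' → e = e' := by
    rintro ⟨⟨⟨v, i⟩, τ⟩, δ⟩ ⟨⟨⟨v', i'⟩, τ'⟩, δ'⟩ hi h
    have hv : v = v' := by
      have h1 := hEA ⟨⟨⟨v, i⟩, τ⟩, δ⟩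
      rw [h, hEA] at h1; exact h1.symm
    subst hv
    have hi' : i = i' := hi
    subst hi'
    have h2 : α (idx τ δ) = α (idx τ' δ') := Subtype.ext (mul_left_cancel h)
    obtain ⟨h3, h4⟩ := hidxinj _ _ _ _ (α.injective h2)
    subst h3; subst h4; rfl
  let ρ : X → Fin (q / t) → (G ⧸ B) × Fin c := fun x δ => ((E (x, δ) : G ⧸ B), x.1.2)
  have hfib : ∀ w, #{e : X × Fin (q / t) | ρ e.1 e.2 = w} ≤ q := by
    rintro ⟨w, i⟩
    obtain ⟨b0, rfl⟩ := QuotientGroup.mk_surjective w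
    have : Fintype B := Fintype.ofFinite B
    have hq' : q = #(univ : Finset B) := by
      rw [← hB, Nat.card_eq_fintype_card]; rfl
    conv_rhs => rw [hq']
    apply Finset.card_le_card_of_injOn
      (fun e => if h : b0⁻¹ * E e ∈ B then (⟨b0⁻¹ * E e, h⟩ : B) else 1)
    · intro e _; simp
    · intro e he e' he' hee
      simp only [coe_filter, mem_univ, true_and, Set.mem_ofPred_eq, ρ, Prod.mk.injEq] at he he'
      have h1 : b0⁻¹ * E e ∈ B := QuotientGroup.eq.1 he.1.symm
      have h2 : b0⁻¹ * E e' ∈ B := QuotientGroup.eq.1 he'.1.symm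
      simp only [h1, h2, dif_pos, Subtype.mk.injEq] at hee
      exact hEinj _ _ (he.2.trans he'.2.symm) (mul_left_cancel hee)
  have hinj : ∀ x, Function.Injective (ρ x) := by
    intro x δ δ' h
    have h1 : (E (x, δ))⁻¹ * E (x, δ') ∈ B := QuotientGroup.eq.1 (congrArg Prod.fst h)
    have h2 : (E (x, δ))⁻¹ * E (x, δ') ∈ A := by
      apply QuotientGroup.eq.1; rw [hEA, hEA]
    have h3 : (E (x, δ))⁻¹ * E (x, δ') ∈ A ⊓ B := ⟨h2, h1⟩
    rw [hAB, Subgroup.mem_bot, inv_mul_eq_one] at h3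
    exact congrArg Prod.snd (hEinj (x, δ) (x, δ') rfl h3)
  have hbase : ∀ x y : ℕ → X × Fin (q / t), (∀ i, ρ (x i).1 (x i).2 = ρ (y i).1 (y i).2 ∧
      x i ≠ y i ∧ (y i).1.1 = (x (i+1)).1.1 ∧ y i ≠ x (i+1)) → x k ≠ x 0 := by
    intro x y h hx
    apply hw (fun i => (E (y i))⁻¹ * E (x (i+1))) (fun i => (E (x i))⁻¹ * E (y i))
      (fun i => E (x i)) _ _ (congrArg E hx)
    · intro i
      obtain ⟨h1, h2, h3, h4⟩ := h i
      refine ⟨?_, ?_, QuotientGroup.eq.1 (congrArg Prod.fst h1), ?_⟩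
      · apply QuotientGroup.eq.1; rw [hEA, hEA]; exact congrArg Prod.fst h3
      · intro h5; rw [inv_mul_eq_one] at h5
        exact h4 (hEinj _ _ (congrArg Prod.snd h3) h5)
      · intro h5; rw [inv_mul_eq_one] at h5
        exact h2 (hEinj _ _ (congrArg (fun r : (G ⧸ B) × Fin c => r.2) h1) h5)
    · intro i; group
  obtain ⟨S, hS, hcard⟩ := perms_of_base (X := X) (R := (G ⧸ B) × Fin c) k (q / t) q
    (fun x => x.1) ρ hfib hinj hbase
  · refine ⟨X, inferInstance, S, hS, ?_, ?_⟩
    · simp [X, Nat.card_eq_fintype_card]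
    · have e1 : Fintype.card X = Nat.card (G ⧸ A) * c * t := by
        simp [X, Nat.card_eq_fintype_card]
      have e2 : Fintype.card ((G ⧸ B) × Fin c) = Nat.card (G ⧸ A) * c := by
        rw [← hqe]; simp [Nat.card_eq_fintype_card]
      rw [e1, e2] at hcard
      exact hcard

end Base

section Numerics

lemma choose_prime (K s Q h : ℕ) (hK : 0 < K) (hs : 0 < s) (hQ : 0 < Q)
    (hh : K * (2 * Q) ^ s ≤ h) :
    ∃ q : ℕ, q.Prime ∧ Q ≤ q ∧ K * q ^ s ≤ h ∧ h < K * (2 * q) ^ s := by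
  have hbig : ∀ y, h < y → h < K * (2 * y) ^ s := by
    intro y hy
    calc h < y := hy
      _ ≤ 2 * y := by omega
      _ ≤ (2 * y) ^ s := Nat.le_self_pow hs.ne' _
      _ ≤ K * (2 * y) ^ s := Nat.le_mul_of_pos_left _ hK
  have hQh : Q ≤ h := by
    by_contra hc
    have := hbig Q (by omega)
    omega
  set y := Nat.findGreatest (fun y => K * (2 * y) ^ s ≤ h) h with hy
  have h1 : K * (2 * y) ^ s ≤ h :=
    Nat.findGreatest_spec (P := fun y => K * (2 * y) ^ s ≤ h) hQh hh
  have h2 : Q ≤ y := Nat.le_findGreatest (P := fun y => K * (2 * y) ^ s ≤ h) hQh hh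
  have h3 : h < K * (2 * (y + 1)) ^ s := by
    rcases le_or_gt (y + 1) h with h4 | h4
    · have := Nat.findGreatest_is_greatest (P := fun y => K * (2 * y) ^ s ≤ h)
        (n := h) (k := y + 1) (by omega) h4
      omega
    · exact hbig _ h4
  obtain ⟨q, hqp, hq1, hq2⟩ := Nat.exists_prime_lt_and_le_two_mul y (by omega)
  refine ⟨q, hqp, by omega, le_trans ?_ h1, lt_of_lt_of_le h3 ?_⟩
  · exact Nat.mul_le_mul_left _ (Nat.pow_le_pow_left hq2 _)
  · exact Nat.mul_le_mul_left _ (Nat.pow_le_pow_left (by omega) _)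

lemma log_bound (q t M N : ℕ) (ht : 3 ≤ t) (hq : t ≤ q)
    (h : (q / t) ^ (2 * (M * t)) ≤ (q + 1) ^ (2 * M) * (3 * q) ^ (M * t) * N) :
    0 < N ∧ ((M * t : ℕ) : ℝ) * ((1 - 2 / (t : ℝ)) * Real.log q -
      (2 * Real.log (2 * t) + Real.log 3 + Real.log 2)) ≤ Real.log N := by
  have hd : 0 < q / t := Nat.div_pos hq (by omega)
  have hN : 0 < N := by
    rcases Nat.eq_zero_or_pos N with h0 | h0
    · subst h0
      have := Nat.pow_pos (n := 2 * (M * t)) hd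
      omega
    · exact h0
  refine ⟨hN, ?_⟩
  have hq0 : (0 : ℝ) < q := by exact_mod_cast (by omega : 0 < q)
  have ht0 : (0 : ℝ) < t := by exact_mod_cast (by omega : 0 < t)
  have hq1 : (1 : ℝ) ≤ q := by exact_mod_cast (by omega : 1 ≤ q)
  have hN0 : (0 : ℝ) < N := by exact_mod_cast hN
  have hd0 : (0 : ℝ) < (q / t : ℕ) := by exact_mod_cast hd
  have h' : ((q / t : ℕ) : ℝ) ^ (2 * (M * t)) ≤
      ((q : ℝ) + 1) ^ (2 * M) * (3 * q) ^ (M * t) * N := by exact_mod_cast h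
  have hl := Real.log_le_log (by positivity) h'
  rw [Real.log_mul (by positivity) (by positivity), Real.log_mul (by positivity) (by positivity),
    Real.log_pow, Real.log_pow, Real.log_pow, Real.log_mul (by norm_num) (by positivity)] at hl
  have hd2 : (q : ℝ) ≤ (q / t : ℕ) * (2 * t) := by
    have h1 : q < (q / t) * t + t := by
      have h3 := Nat.div_add_mod q t
      have h4 := Nat.mod_lt q (by omega : t > 0)
      nlinarith
    have h2 : q ≤ (q / t) * (2 * t) := by nlinarith
    exact_mod_cast h2
  have hl1 := Real.log_le_log hq0 hd2
  rw [Real.log_mul (by positivity) (by positivity)] at hl1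
  have hl2 : Real.log (q + 1) ≤ Real.log 2 + Real.log q := by
    rw [← Real.log_mul (by norm_num) (by positivity)]
    exact Real.log_le_log (by positivity) (by linarith)
  have hlog2 : 0 ≤ Real.log 2 := Real.log_nonneg (by norm_num)
  push_cast at hl ⊢
  have hM : (0 : ℝ) ≤ M := by positivity
  have ht3 : (3 : ℝ) ≤ t := by exact_mod_cast ht
  have e1 := mul_le_mul_of_nonneg_left hl1 (mul_nonneg hM ht0.le)
  have e2 := mul_le_mul_of_nonneg_left hl2 hM
  have e3 : (M : ℝ) * Real.log 2 * 2 ≤ M * t * Real.log 2 := by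
    have := mul_nonneg hM hlog2
    nlinarith
  have e4 : (M : ℝ) * t * ((1 - 2 / (t : ℝ)) * Real.log q -
      (2 * Real.log (2 * t) + Real.log 3 + Real.log 2)) =
      M * t * Real.log q - 2 * M * Real.log q - 2 * (M * t * Real.log (2 * t))
       - M * t * Real.log 3 - M * t * Real.log 2 := by
    field_simp
    ring
  rw [e4]
  nlinarith

lemma final_ineq (α ε t s x l P C L : ℝ) (ht : 3 ≤ t) (hs : 2 ≤ s) (hα : α ≤ 1 / (2 * s))
    (hε : 2 ≤ ε * t) (hx : 0 ≤ x) (hl : 0 ≤ l) (hC : 0 ≤ C)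
    (h1 : C * s * t ≤ l) (h2 : C ≤ ε * l) (hP : (1 - 2 / t) / s * l - C ≤ P)
    (y : ℝ) (hy : (1 - 1 / t) * (x / 2) ≤ y) (hL : y * P ≤ L) :
    (α - ε) * x * l ≤ L := by
  have ht0 : 0 < t := by linarith
  have hs0 : 0 < s := by linarith
  have hP0 : 0 ≤ (1 - 2 / t) / s * l - C := by
    have : C * s * t ≤ (t - 2) * l := by nlinarith
    have e : (1 - 2 / t) / s * l - C = ((t - 2) * l - C * s * t) / (s * t) := by
      field_simp
    rw [e]; apply div_nonneg <;> nlinarith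
  have ht1 : 0 ≤ 1 - 1 / t := by
    rw [sub_nonneg, div_le_one ht0]; linarith
  have hx2 : 0 ≤ (1 - 1 / t) * (x / 2) := by positivity
  have hyP : (1 - 1 / t) * (x / 2) * ((1 - 2 / t) / s * l - C) ≤ L :=
    le_trans (mul_le_mul hy hP hP0 (hx2.trans hy)) hL
  refine le_trans ?_ hyP
  have hu : 0 ≤ 1 / t := by positivity
  have hut : 1 / t ≤ ε / 2 := by
    rw [div_le_div_iff₀ ht0 (by norm_num)]; linarith
  have hv : 0 ≤ 1 / s := by positivity
  have hv2 : 1 / s ≤ 1 / 2 := by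
    rw [div_le_div_iff₀ hs0 (by norm_num)]; linarith
  have ea : 1 / (2 * s) = (1 / s) / 2 := by field_simp
  have eb : (1 - 2 / t) / s = (1 - 2 * (1 / t)) * (1 / s) := by ring
  rw [ea] at hα
  rw [eb]
  generalize 1 / t = u at *
  generalize 1 / s = v at *
  have key : (α - ε) * l ≤ (1 - u) * ((1 - 2 * u) * v * l - C) / 2 := by
    have k1 : (1 - u) * (1 - 2 * u) * v ≥ v - 3 * u / 2 := by
      nlinarith [mul_nonneg hu hv, mul_nonneg (mul_nonneg hu hu) hv]
    have k2 : (1 - u) * C ≤ C := by nlinarith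
    have k3 : α - ε ≤ (1 - u) * (1 - 2 * u) * v / 2 - ε / 2 := by linarith
    have k4 := mul_le_mul_of_nonneg_right k3 hl
    nlinarith
  have := mul_le_mul_of_nonneg_left key hx
  nlinarith

lemma main_bound (k : ℕ) (hk : 2 ≤ k) (ε : ℝ) (hε : 0 < ε) :
    ∃ N : ℕ, ∀ n h : ℕ, N ≤ n → n = 2 * h →
      ∃ S : Finset (Equiv.Perm (Fin h)), GoodFam k S ∧
        (n : ℝ) ^ ((1 / (3 * (k : ℝ) - 2) - ε) * n) ≤ (S.card : ℝ) := by
  obtain ⟨t0, ht0⟩ := exists_nat_ge (2 / ε)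
  set t := max t0 3 with htdef
  have ht : 3 ≤ t := le_max_right _ _
  have htr : (3 : ℝ) ≤ t := by exact_mod_cast ht
  have hεt : 2 ≤ ε * t := by
    have h1 : (t0 : ℝ) ≤ t := by exact_mod_cast le_max_left _ _
    have h2 : 2 / ε ≤ t := ht0.trans h1
    rw [div_le_iff₀ hε] at h2; linarith
  set s := k + k / 2 - 1 with hsdef
  have hs : 2 ≤ s := by omega
  have hsr : (2 : ℝ) ≤ s := by exact_mod_cast hs
  have hα : 1 / (3 * (k : ℝ) - 2) ≤ 1 / (2 * (s : ℝ)) := by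
    have h1 : 2 * s + 2 ≤ 3 * k := by omega
    have h2 : 2 * (s : ℝ) + 2 ≤ 3 * k := by exact_mod_cast h1
    apply one_div_le_one_div_of_le <;> linarith
  set C1 : ℝ := 2 * Real.log (2 * t) + Real.log 3 + Real.log 2 with hC1
  set D : ℝ := Real.log 2 + Real.log ((t : ℝ) ^ 2 * 2 ^ s) with hD
  have hC1' : 0 ≤ C1 := by
    have a1 : 0 ≤ Real.log (2 * t) := Real.log_nonneg (by linarith)
    have a2 : 0 ≤ Real.log 3 := Real.log_nonneg (by norm_num)
    have a3 : 0 ≤ Real.log 2 := Real.log_nonneg (by norm_num)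
    linarith
  have hD' : 0 ≤ D := by
    have a3 : 0 ≤ Real.log 2 := Real.log_nonneg (by norm_num)
    have a4 : 0 ≤ Real.log ((t : ℝ) ^ 2 * 2 ^ s) :=
      Real.log_nonneg (one_le_mul_of_one_le_of_one_le (one_le_pow₀ (by linarith))
        (one_le_pow₀ (by norm_num)))
    linarith
  set a : ℝ := (1 - 2 / (t : ℝ)) / s with ha
  have h12 : 0 ≤ 1 - 2 / (t : ℝ) := by
    rw [sub_nonneg, div_le_one (by linarith)]; linarith
  have ha0 : 0 ≤ a := by positivity
  set C : ℝ := a * D + C1 with hC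
  have hC0 : 0 ≤ C := by positivity
  obtain ⟨N0, hN0⟩ := (Filter.tendsto_atTop.1
    (Real.tendsto_log_atTop.comp tendsto_natCast_atTop_atTop)
    (max (C * s * t) (C / ε))).exists_forall_of_atTop
  refine ⟨max N0 (max 1 (2 * (t ^ 2 * (2 * t) ^ s))), fun n h hn hnh => ?_⟩
  have hnN := hN0 n (le_trans (le_max_left _ _) hn)
  have hn2 := (le_max_right _ _).trans hn
  have hn1 : 1 ≤ n := (le_max_left _ _).trans hn2
  have hn3 : 2 * (t ^ 2 * (2 * t) ^ s) ≤ n := (le_max_right _ _).trans hn2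
  simp only [Function.comp] at hnN
  have hl1 : C * s * t ≤ Real.log n := (le_max_left _ _).trans hnN
  have hl2 : C ≤ ε * Real.log n := by
    have := (le_max_right _ _).trans hnN
    rw [div_le_iff₀ hε] at this; linarith
  have hnr : (1 : ℝ) ≤ n := by exact_mod_cast hn1
  have hl0 : 0 ≤ Real.log n := Real.log_nonneg hnr
  obtain ⟨q, hqp, hqt, hq1, hq2⟩ := choose_prime (t ^ 2) s t h (by positivity) (by omega)
    (by omega) (by omega)
  obtain ⟨m0, hm0, hm0q, hfam⟩ := base_family k q t hk hqp
  obtain ⟨X, _, S0, hS0, hXc, hcount⟩ := hfam (h / (m0 * t))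
  set M := m0 * (h / (m0 * t)) with hM
  have hmt : 0 < m0 * t := by positivity
  have hdm := Nat.div_add_mod h (m0 * t)
  have hml := Nat.mod_lt h hmt
  have hMt : M * t = m0 * t * (h / (m0 * t)) := by rw [hM]; ring
  have hXh : Fintype.card X ≤ Fintype.card (Fin h) := by
    rw [hXc, Fintype.card_fin]; omega
  obtain ⟨S, hS, hSc⟩ := goodFam_pad (Y := Fin h) k hXh S0 hS0
  refine ⟨S, hS, ?_⟩
  rw [hSc]
  obtain ⟨hpos, hlog⟩ := log_bound q t M S0.card ht hqt hcount
  have hposr : (0 : ℝ) < S0.card := by exact_mod_cast hpos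
  rw [← Real.log_le_log_iff (Real.rpow_pos_of_pos (by linarith) _) hposr,
    Real.log_rpow (by linarith)]
  have hq0 : (0 : ℝ) < q := by exact_mod_cast hqp.pos
  have hnh' : (n : ℝ) = 2 * h := by exact_mod_cast hnh
  have hh0 : (0 : ℝ) < h := by linarith
  refine final_ineq _ ε t s n (Real.log n)
    ((1 - 2 / (t : ℝ)) * Real.log q - C1) C _ htr hsr hα hεt (by linarith) hl0 hC0 hl1 hl2 ?_
    ((M * t : ℕ) : ℝ) ?_ hlog
  · have b1 : (h : ℝ) ≤ (t : ℝ) ^ 2 * 2 ^ s * (q : ℝ) ^ s := by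
      have : h ≤ t ^ 2 * 2 ^ s * q ^ s := by
        rw [mul_pow] at hq2; rw [mul_assoc]; exact hq2.le
      exact_mod_cast this
    have b2 := Real.log_le_log hh0 b1
    rw [Real.log_mul (by positivity) (by positivity), Real.log_pow] at b2
    have b3 : Real.log n = Real.log 2 + Real.log h := by
      rw [hnh', Real.log_mul (by norm_num) hh0.ne']
    have b4 : Real.log n - D ≤ s * Real.log q := by linarith
    have b5 := mul_le_mul_of_nonneg_left b4 ha0
    have b6 : a * (s * Real.log q) = (1 - 2 / (t : ℝ)) * Real.log q := by
      rw [ha]; field_simp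
    rw [b6] at b5
    linarith
  · have c1 : h ≤ M * t + m0 * t := by omega
    have c2 : m0 * t * t ≤ h := by
      refine le_trans ?_ hq1
      calc m0 * t * t ≤ q ^ s * t * t := by gcongr
        _ = t ^ 2 * q ^ s := by ring
    have c1' : (h : ℝ) ≤ ((M * t : ℕ) : ℝ) + m0 * t := by exact_mod_cast c1
    have c2' : (m0 : ℝ) * t * t ≤ h := by exact_mod_cast c2
    have c3 : (m0 : ℝ) * t ≤ h / t := by
      rw [le_div_iff₀ (by linarith)]; exact c2'
    have c4 : (1 - 1 / (t : ℝ)) * (n / 2) = h - h / t := by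
      rw [hnh']; field_simp
    rw [c4]; linarith

end Numerics

/-- There are at least `n^((1/(3k-2))n - o(n))` pairwise non-`C₂ₖ`-creating
perfect matchings on `n` vertices, for even `n`. -/
theorem stmt_16 (k : ℕ) (hk : 2 ≤ k) :
    ∀ ε : ℝ, 0 < ε → ∃ N : ℕ, ∀ n : ℕ, N ≤ n → Even n →
      ∃ F : Finset (SimpleGraph (Fin n)),
        (∀ G ∈ F, IsPMGraph G) ∧
        (∀ G₁ ∈ F, ∀ G₂ ∈ F, G₁ ≠ G₂ → ¬ContainsCycleLen (G₁ ⊔ G₂) (2 * k)) ∧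
        (n : ℝ) ^ ((1 / (3 * (k : ℝ) - 2) - ε) * n) ≤ (F.card : ℝ) := by
  intro ε hε
  obtain ⟨N, hN⟩ := main_bound k hk ε hε
  refine ⟨N, fun n hn he => ?_⟩
  obtain ⟨h, hh⟩ := he
  obtain ⟨S, hS, hb⟩ := hN n h hn (by omega)
  obtain ⟨F, h1, h2, h3⟩ := graphs_of_perms k n h hk (by omega) S hS
  exact ⟨F, h1, h2, by rw [h3]; exact hb⟩
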